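/- Let T > 0, σ_X > 0, σ_Y > 0, γ° > 0, û ≠ 0 a real constant, and continuous functions β1, β3 : [0,T] → ℝ. Define α(t, χ) := β3(t) + β1(t)·χ and δ1 := û·α, and let (γ, χ) be the unique C¹ solution on [0,T] of γ' = −γ²α²/σ_Y², γ(0) = γ°, and χ' = γα²(1−χ)/σ_Y² − γχ²·û²α²/σ_X², χ(0) = 0. Set k := σ_Y²û²/σ_X², c2 := (√(1+4k) − 1)/(2k), c1 := (√(1+4k) + 1)/(2k), d := √(1+4k); these constants are positive and do not depend on γ° or on T. Then for all t ∈ [0,T]: χ(t) = c1·c2·(1 − (γ(t)/γ°)^d)/(c1 + c2·(γ(t)/γ°)^d), and 0 ≤ χ(t) < c2 < 1. -/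

import Mathlib

open Set

noncomputable def kP (σX σY u : ℝ) : ℝ := σY^2 * u^2 / σX^2

noncomputable def c2P (σX σY u : ℝ) : ℝ :=
  (Real.sqrt (1 + 4 * kP σX σY u) - 1) / (2 * kP σX σY u)

noncomputable def c1P (σX σY u : ℝ) : ℝ :=
  (Real.sqrt (1 + 4 * kP σX σY u) + 1) / (2 * kP σX σY u)

noncomputable def dP (σX σY u : ℝ) : ℝ := Real.sqrt (1 + 4 * kP σX σY u)

/-- A solution of the homogeneous scalar linear ODE with coefficient `g` is its initial value times a positive
factor. -/
theorem exists_pos_mul_of_linear_ode {T : ℝ} (hT : 0 < T) {f g : ℝ → ℝ}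
    (hg : ContinuousOn g (Icc 0 T))
    (hf : ∀ t ∈ Icc (0:ℝ) T, HasDerivWithinAt f (g t * f t) (Icc 0 T) t) :
    ∀ t ∈ Icc (0:ℝ) T, ∃ e : ℝ, 0 < e ∧ f t = f 0 * e := by
  have hext : Continuous (IccExtend hT.le ((Icc 0 T).domRestrict g)) :=
    hg.domRestrict.Icc_extend'
  set G : ℝ → ℝ := fun t => ∫ s in (0:ℝ)..t, IccExtend hT.le ((Icc 0 T).domRestrict g) s with hG
  have hGderiv : ∀ t ∈ Icc (0:ℝ) T, HasDerivWithinAt G (g t) (Icc 0 T) t := by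
    intro t ht
    have h := (hext.integral_hasStrictDerivAt 0 t).hasDerivAt
    rw [IccExtend_of_mem hT.le _ ht] at h
    exact h.hasDerivWithinAt
  have hprod : ∀ t ∈ Icc (0:ℝ) T,
      HasDerivWithinAt (fun t => f t * Real.exp (-G t)) 0 (Icc 0 T) t := by
    intro t ht
    refine ((hf t ht).mul (hGderiv t ht).fun_neg.exp).congr_deriv ?_
    ring
  have hconst := constant_of_derivWithin_zero
    (fun t ht => (hprod t ht).differentiableWithinAt)
    (fun t ht => (hprod t (Ico_subset_Icc_self ht)).derivWithin
      (uniqueDiffOn_Icc hT t (Ico_subset_Icc_self ht)))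
  have hG0 : G 0 = 0 := by simp [hG]
  intro t ht
  refine ⟨Real.exp (G t), Real.exp_pos _, ?_⟩
  have h := hconst t ht
  simp only [hG0, neg_zero, Real.exp_zero, mul_one] at h
  rw [← h, mul_assoc, ← Real.exp_add, neg_add_cancel, Real.exp_zero, mul_one]

theorem kP_pos {σX σY u : ℝ} (hσX : 0 < σX) (hσY : 0 < σY) (hu : u ≠ 0) :
    0 < kP σX σY u := by
  unfold kP
  positivity

theorem one_lt_dP {σX σY u : ℝ} (hk : 0 < kP σX σY u) : 1 < dP σX σY u := by
  unfold dP
  rw [Real.lt_sqrt zero_le_one]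
  linarith

theorem dP_sq {σX σY u : ℝ} (hk : 0 < kP σX σY u) :
    dP σX σY u ^ 2 = 1 + 4 * kP σX σY u :=
  Real.sq_sqrt (by linarith)

/-- In a private-value environment (`δ1 = û·α`), the second-order-belief weight
`χ` is a time-invariant function of the posterior variance `γ`, uniformly
bounded above by `c2 < 1` (Cisternas–Kolb, Lemma "One-to-one mapping"). -/
theorem stmt_7 (T σX σY γo u : ℝ) (hT : 0 < T) (hσX : 0 < σX) (hσY : 0 < σY)
    (hγo : 0 < γo) (hu : u ≠ 0) (β1 β3 : ℝ → ℝ)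
    (hβ1 : ContinuousOn β1 (Icc 0 T)) (hβ3 : ContinuousOn β3 (Icc 0 T))
    (γ χ : ℝ → ℝ)
    (hγC1 : ContDiffOn ℝ 1 γ (Icc 0 T)) (hχC1 : ContDiffOn ℝ 1 χ (Icc 0 T))
    (hγode : ∀ t ∈ Icc (0:ℝ) T,
      HasDerivWithinAt γ (-(γ t)^2 * (β3 t + β1 t * χ t)^2 / σY^2) (Icc 0 T) t)
    (hχode : ∀ t ∈ Icc (0:ℝ) T,
      HasDerivWithinAt χ
        (γ t * (β3 t + β1 t * χ t)^2 * (1 - χ t) / σY^2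
          - γ t * (χ t)^2 * u^2 * (β3 t + β1 t * χ t)^2 / σX^2) (Icc 0 T) t)
    (hγ0 : γ 0 = γo) (hχ0 : χ 0 = 0) :
    0 < c1P σX σY u ∧ 0 < c2P σX σY u ∧ 0 < dP σX σY u ∧ c2P σX σY u < 1 ∧
    ∀ t ∈ Icc (0:ℝ) T,
      χ t = c1P σX σY u * c2P σX σY u * (1 - (γ t / γo) ^ dP σX σY u) /
              (c1P σX σY u + c2P σX σY u * (γ t / γo) ^ dP σX σY u) ∧
      0 ≤ χ t ∧ χ t < c2P σX σY u := by
  have hk := kP_pos hσX hσY hu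
  have hd1 := one_lt_dP hk
  have hd2 := dP_sq hk
  have hc1e : c1P σX σY u = (dP σX σY u + 1) / (2 * kP σX σY u) := rfl
  have hc2e : c2P σX σY u = (dP σX σY u - 1) / (2 * kP σX σY u) := rfl
  have hke : kP σX σY u = σY^2 * u^2 / σX^2 := rfl
  generalize c1P σX σY u = c1 at *
  generalize c2P σX σY u = c2 at *
  generalize dP σX σY u = d at *
  generalize kP σX σY u = k at *
  have hd0 : 0 < d := by linarith
  have hc1 : 0 < c1 := by rw [hc1e]; positivity
  have hc2 : 0 < c2 := by
    rw [hc2e]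
    exact div_pos (by linarith) (by linarith)
  have hc21 : c2 < 1 := by
    rw [hc2e, div_lt_one (by linarith)]
    nlinarith
  have hprod : k * (c1 * c2) = 1 := by
    rw [hc1e, hc2e]
    field_simp
    linarith
  have hdiff : k * (c1 - c2) = 1 := by
    rw [hc1e, hc2e]
    field_simp
    ring
  have hsum : k * (c1 + c2) = d := by
    rw [hc1e, hc2e]
    field_simp
    ring
  have hγc := hγC1.continuousOn
  have hχc := hχC1.continuousOn
  set A : ℝ → ℝ := fun t => (β3 t + β1 t * χ t)^2 / σY^2 with hA
  have hAc : ContinuousOn A (Icc 0 T) :=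
    ((hβ3.add (hβ1.mul hχc)).pow 2).div_const _
  have hA0 : ∀ t, 0 ≤ A t := fun t => by positivity
  have hγ' : ∀ t ∈ Icc (0:ℝ) T, HasDerivWithinAt γ (-(γ t * A t) * γ t) (Icc 0 T) t := by
    intro t ht
    convert hγode t ht using 1
    simp only [hA]
    ring
  have hχ' : ∀ t ∈ Icc (0:ℝ) T,
      HasDerivWithinAt χ (γ t * A t * (1 - χ t - k * χ t ^ 2)) (Icc 0 T) t := by
    intro t ht
    convert hχode t ht using 1
    simp only [hA, hke]
    field_simp
  have hγpos : ∀ t ∈ Icc (0:ℝ) T, 0 < γ t := by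
    intro t ht
    obtain ⟨e, he, h⟩ := exists_pos_mul_of_linear_ode hT (hγc.mul hAc).neg hγ' t ht
    rw [h, hγ0]
    positivity
  have hanti : AntitoneOn γ (Icc 0 T) := by
    refine antitoneOn_of_hasDerivWithinAt_nonpos (convex_Icc 0 T) hγc
      (fun t ht => (hγ' t (interior_subset ht)).mono interior_subset) (fun t ht => ?_)
    have := mul_nonneg (mul_nonneg (hγpos t (interior_subset ht)).le (hA0 t))
      (hγpos t (interior_subset ht)).le
    linarith
  set r : ℝ → ℝ := fun t => (γ t / γo) ^ d with hr
  have hr' : ∀ t ∈ Icc (0:ℝ) T, HasDerivWithinAt r (-(d * (γ t * A t) * r t)) (Icc 0 T) t := by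
    intro t ht
    have hq : 0 < γ t / γo := div_pos (hγpos t ht) hγo
    convert ((hγ' t ht).div_const γo).rpow_const (p := d) (Or.inl hq.ne') using 1
    simp only [hr]
    rw [Real.rpow_sub_one hq.ne']
    have := (hγpos t ht).ne'
    field_simp
  set W : ℝ → ℝ := fun t => (c2 - χ t) * c1 - (c1 + χ t) * (c2 * r t) with hW
  have hW' : ∀ t ∈ Icc (0:ℝ) T,
      HasDerivWithinAt W (-(γ t * A t * (k * (c1 + χ t))) * W t) (Icc 0 T) t := by
    intro t ht
    refine ((((hχ' t ht).const_sub c2).mul_const c1).sub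
      (((hχ' t ht).const_add c1).mul ((hr' t ht).const_mul c2))).congr_deriv ?_
    have hfac : 1 - χ t - k * χ t ^ 2 = k * (c2 - χ t) * (c1 + χ t) := by
      linear_combination -hprod + χ t * hdiff
    rw [hfac, ← hsum]
    simp only [hW]
    ring
  have hW0 : W 0 = 0 := by
    simp only [hW, hr, hγ0, hχ0, div_self hγo.ne', Real.one_rpow]
    ring
  refine ⟨hc1, hc2, hd0, hc21, fun t ht => ?_⟩
  have hWt : W t = 0 := by
    obtain ⟨e, -, h⟩ := exists_pos_mul_of_linear_ode hT
      ((hγc.mul hAc).mul ((hχc.const_add c1).const_mul k)).neg hW' t ht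
    rw [h, hW0, zero_mul]
  have hr0 : 0 < r t := Real.rpow_pos_of_pos (div_pos (hγpos t ht) hγo) d
  have hr1 : r t ≤ 1 := by
    refine Real.rpow_le_one (div_pos (hγpos t ht) hγo).le ?_ hd0.le
    rw [div_le_one hγo, ← hγ0]
    exact hanti (left_mem_Icc.2 hT.le) ht ht.1
  have hden : 0 < c1 + c2 * r t := by positivity
  have hχt : χ t = c1 * c2 * (1 - r t) / (c1 + c2 * r t) := by
    rw [eq_div_iff hden.ne']
    simp only [hW] at hWt
    linear_combination -hWt
  refine ⟨hχt, ?_, ?_⟩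
  · rw [hχt]
    exact div_nonneg (mul_nonneg (by positivity) (by linarith)) hden.le
  · rw [hχt, div_lt_iff₀ hden]
    have h1 : 0 < c1 * c2 * r t := by positivity
    have h2 : 0 < c2 * c2 * r t := by positivity
    linarith
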